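/- arXiv:2412.02179 — 2 statements merged into one kernel-verified Lean document; each statement's English description precedes it below -/
import Mathlib

section
/- Let G be a finite connected simple graph, u a vertex of G of degree d ≥ 2 with incident edges e₁, …, e_d, and let G_cut be the graph obtained from G by introducing a new vertex ū and re-joining e₂, …, e_d to ū instead of u (so that e₁ is the only edge of G_cut incident to u); assume G_cut is connected, identify E(G_cut) ≅ E(G), and equip G_cut with the same edge-length function l. Then λ₁(G_cut, l) ≤ λ₁(G, l). -/
open Finset Filter Topology
open scoped Classical ENNReal

noncomputable section

variable {V : Type*} [Fintype V]

/-- The set of neighbors of `u` as a `Finset`. -/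
def nbr (G : SimpleGraph V) (u : V) : Finset V :=
  Finset.univ.filter (fun v => G.Adj u v)

/-- The vertex-weight `m₀(u) = ∑_{v ∼ u} l(uv)` induced by the edge-length function `l`. -/
def m0 (G : SimpleGraph V) (l : V → V → ℝ) (u : V) : ℝ :=
  ∑ v ∈ nbr G u, l u v

/-- The Fujiwara Laplacian `(Δ_l φ)(u) = ∑_{v ∼ u} (m₁(uv)/m₀(u)) (φ(u) − φ(v))`,
where `m₁(uv) = 1/l(uv)`. -/
def lap (G : SimpleGraph V) (l : V → V → ℝ) (φ : V → ℝ) (u : V) : ℝ :=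
  ∑ v ∈ nbr G u, ((1 / l u v) / m0 G l u) * (φ u - φ v)

/-- `l` is an edge-length function: symmetric and positive on adjacent pairs. -/
def IsLength (G : SimpleGraph V) (l : V → V → ℝ) : Prop :=
  (∀ u v, l u v = l v u) ∧ ∀ u v, G.Adj u v → 0 < l u v

/-- The Dirichlet energy `∑_{uv ∈ E} m₁(uv) (φ(u) − φ(v))²`
(each edge counted once, via half the sum over ordered adjacent pairs). -/
def energy (G : SimpleGraph V) (l : V → V → ℝ) (φ : V → ℝ) : ℝ :=
  (1/2) * ∑ u, ∑ v ∈ nbr G u, (1 / l u v) * (φ u - φ v) ^ 2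

/-- The squared norm `∑_{u ∈ V} m₀(u) φ(u)²`. -/
def mass (G : SimpleGraph V) (l : V → V → ℝ) (φ : V → ℝ) : ℝ :=
  ∑ u, m0 G l u * φ u ^ 2

/-- The first nonzero eigenvalue of the Fujiwara Laplacian, via its variational
characterization as the infimum of the Rayleigh quotient over nonzero functions
orthogonal to the constants. -/
def lambda1 (G : SimpleGraph V) (l : V → V → ℝ) : ℝ :=
  sInf { r | ∃ φ : V → ℝ, φ ≠ 0 ∧ (∑ u, m0 G l u * φ u) = 0 ∧
    r = energy G l φ / mass G l φ }

/-- The largest eigenvalue of the Fujiwara Laplacian, via its variational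
characterization as the supremum of the Rayleigh quotient. -/
def lambdaMax (G : SimpleGraph V) (l : V → V → ℝ) : ℝ :=
  sSup { r | ∃ φ : V → ℝ, φ ≠ 0 ∧ r = energy G l φ / mass G l φ }

/-- `Λ₁(G)`: the supremum, in `[0, ∞]`, of `λ₁(G, l)` over all edge-length functions `l`
normalized by `∑_{u ∈ V} m₀(u) = 1`. -/
def Lambda1 (G : SimpleGraph V) : ℝ≥0∞ :=
  ⨆ (l : V → V → ℝ) (_ : IsLength G l ∧ (∑ u, m0 G l u) = 1),
    ENNReal.ofReal (lambda1 G l)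

/-- `μ` is the nondecreasing sequence of eigenvalues (with multiplicity) of the
Fujiwara Laplacian `Δ_l`: it is monotone and admits a corresponding family of
eigenfunctions that is orthonormal for the inner product `⟨φ, ψ⟩ = ∑ m₀(u) φ(u) ψ(u)`. -/
def IsLapEigSeq (G : SimpleGraph V) (l : V → V → ℝ)
    (μ : Fin (Fintype.card V) → ℝ) : Prop :=
  Monotone μ ∧ ∃ φ : Fin (Fintype.card V) → V → ℝ,
    (∀ i u, lap G l (φ i) u = μ i * φ i u) ∧
    (∀ i j, (∑ u, m0 G l u * φ i u * φ j u) = if i = j then 1 else 0)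


/-- The graph `G_cut` obtained from `G` by cutting at the vertex `u`: a new clone
vertex `ū` (here `none`) is introduced, and every edge of `G` at `u` other than the
edge `u w₁` is re-joined to `ū` instead of `u`. The old vertices are embedded via
`some`, so `u w₁` is the only edge of `G_cut` incident to `u`. -/
def cutAt (G : SimpleGraph V) (u w₁ : V) : SimpleGraph (Option V) :=
  SimpleGraph.fromRel (fun a b =>
    (∃ x y, a = some x ∧ b = some y ∧ G.Adj x y ∧ (x = u → y = w₁) ∧ (y = u → x = w₁)) ∨
    (∃ y, a = none ∧ b = some y ∧ G.Adj u y ∧ y ≠ w₁))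

/-- The edge-length function on `G_cut` corresponding to `l` under the natural
identification `E(G_cut) ≅ E(G)`: an edge between old vertices keeps its length, and
an edge from the clone vertex `ū` to `y` has the length `l(u, y)` of the original
edge `u y`. -/
def cutLen (l : V → V → ℝ) (u : V) : Option V → Option V → ℝ
  | some x, some y => l x y
  | some x, none => l u x
  | none, some y => l u y
  | none, none => 1

/-- The projection `G_cut → G` that glues the clone vertex back to `u`. -/
def glue (u : V) (a : Option V) : V := a.getD u

lemma cutAt_adj_some_some {W : Type*} {G : SimpleGraph W} {u w x y : W} :
    (cutAt G u w).Adj (some x) (some y) ↔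
      G.Adj x y ∧ (x = u → y = w) ∧ (y = u → x = w) := by
  simp only [cutAt, SimpleGraph.fromRel_adj]
  constructor
  · rintro ⟨-, (⟨x', y', hx, hy, h⟩ | ⟨y', h, -⟩) | (⟨x', y', hx, hy, h⟩ | ⟨y', h, -⟩)⟩
    · cases hx; cases hy; exact h
    · cases h
    · cases hx; cases hy; exact ⟨h.1.symm, h.2.2, h.2.1⟩
    · cases h
  · intro h
    exact ⟨fun e => h.1.ne (Option.some.inj e), Or.inl (Or.inl ⟨x, y, rfl, rfl, h⟩)⟩

lemma cutAt_adj_none_some {W : Type*} {G : SimpleGraph W} {u w y : W} :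
    (cutAt G u w).Adj none (some y) ↔ G.Adj u y ∧ y ≠ w := by
  simp [cutAt, SimpleGraph.fromRel_adj]

/-- A sum over oriented edges of `G_cut` of a quantity pulled back along `glue` equals the
corresponding sum over oriented edges of `G`. -/
lemma sum_nbr_cutAt {G : SimpleGraph V} {u w : V} (f : V → V → ℝ) :
    ∑ a, ∑ b ∈ nbr (cutAt G u w) a, f (glue u a) (glue u b) =
      ∑ x, ∑ y ∈ nbr G x, f x y := by
  have split (x y : V) : (if G.Adj x y then f x y else 0) =
      (if (cutAt G u w).Adj (some x) (some y) then f x y else 0) +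
      (if x = u then (if (cutAt G u w).Adj none (some y) then f x y else 0) else 0) +
      (if y = u then (if (cutAt G u w).Adj (some x) none then f x y else 0) else 0) := by
    rw [(cutAt G u w).adj_comm (some x) none]
    simp only [cutAt_adj_some_some, cutAt_adj_none_some]
    have hcomm := G.adj_comm x y
    by_cases hx : x = u <;> by_cases hy : y = u
    · subst hx hy; simp
    · subst hx
      by_cases hw : y = w
      · subst hw; simp [hy]
      · simp [hy, hw]
    · subst hy
      by_cases hw : x = w
      · subst hw; simp [hx]
      · simp [hx, hw, hcomm]
    · simp [hx, hy]
  simp only [nbr, Finset.sum_filter, Fintype.sum_option, split, glue, Option.getD_none,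
    Option.getD_some, Finset.sum_add_distrib, SimpleGraph.irrefl, if_false, zero_add]
  rw [Finset.sum_comm (f := fun x y => if x = u then _ else _)]
  simp only [Finset.sum_ite_eq', Finset.mem_univ, if_true]
  ring

lemma cutLen_eq {G : SimpleGraph V} {l : V → V → ℝ} (hl : IsLength G l) {u w : V}
    {a b : Option V} (h : b ∈ nbr (cutAt G u w) a) :
    cutLen l u a b = l (glue u a) (glue u b) := by
  rcases a with _ | x <;> rcases b with _ | y
  · simp [nbr] at h
  · rfl
  · exact hl.1 u x
  · rfl

lemma energy_cutAt {G : SimpleGraph V} {l : V → V → ℝ} (hl : IsLength G l) {u w : V}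
    (φ : V → ℝ) :
    energy (cutAt G u w) (cutLen l u) (φ ∘ glue u) = energy G l φ := by
  unfold energy
  rw [← sum_nbr_cutAt (u := u) (w := w)]
  congr 1
  refine Finset.sum_congr rfl fun a _ => Finset.sum_congr rfl fun b hb => ?_
  rw [cutLen_eq hl hb]
  rfl

lemma sum_m0_cutAt {G : SimpleGraph V} {l : V → V → ℝ} (hl : IsLength G l) {u w : V}
    (g : V → ℝ) :
    ∑ a, m0 (cutAt G u w) (cutLen l u) a * g (glue u a) = ∑ x, m0 G l x * g x := by
  simp only [m0, Finset.sum_mul]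
  rw [← sum_nbr_cutAt (u := u) (w := w)]
  refine Finset.sum_congr rfl fun a _ => Finset.sum_congr rfl fun b hb => ?_
  rw [cutLen_eq hl hb]

lemma isLength_cutLen {W : Type*} {G : SimpleGraph W} {l : W → W → ℝ} (hl : IsLength G l)
    (u w : W) :
    IsLength (cutAt G u w) (cutLen l u) := by
  refine ⟨fun a b => ?_, fun a b h => ?_⟩
  · rcases a with _ | x <;> rcases b with _ | y
    · rfl
    · rfl
    · rfl
    · exact hl.1 x y
  · rcases a with _ | x <;> rcases b with _ | y
    · exact zero_lt_one
    · exact hl.2 u y (cutAt_adj_none_some.1 h).1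
    · exact hl.2 u x (cutAt_adj_none_some.1 h.symm).1
    · exact hl.2 x y (cutAt_adj_some_some.1 h).1

lemma IsLength.pos_of_mem_nbr {G : SimpleGraph V} {l : V → V → ℝ} (hl : IsLength G l)
    {u v : V} (h : v ∈ nbr G u) : 0 < l u v :=
  hl.2 u v (by simpa [nbr] using h)

lemma m0_nonneg {G : SimpleGraph V} {l : V → V → ℝ} (hl : IsLength G l) (u : V) :
    0 ≤ m0 G l u :=
  Finset.sum_nonneg fun _ hv => (hl.pos_of_mem_nbr hv).le

lemma rayleigh_nonneg {G : SimpleGraph V} {l : V → V → ℝ} (hl : IsLength G l) (φ : V → ℝ) :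
    0 ≤ energy G l φ / mass G l φ := by
  refine div_nonneg (mul_nonneg (by norm_num) ?_) ?_
  · refine Finset.sum_nonneg fun u _ => Finset.sum_nonneg fun v hv => ?_
    have := hl.pos_of_mem_nbr hv
    positivity
  · exact Finset.sum_nonneg fun u _ => mul_nonneg (m0_nonneg hl u) (sq_nonneg _)

/-- On a graph with an edge there is a nonzero function orthogonal to the constants. -/
lemma exists_ne_zero_sum_m0_eq_zero {G : SimpleGraph V} {l : V → V → ℝ} (hl : IsLength G l)
    {u w : V} (hadj : G.Adj u w) :
    ∃ φ : V → ℝ, φ ≠ 0 ∧ ∑ x, m0 G l x * φ x = 0 := by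
  have hpos : 0 < m0 G l w :=
    Finset.sum_pos (fun _ hv => hl.pos_of_mem_nbr hv) ⟨u, by simpa [nbr] using hadj.symm⟩
  refine ⟨Pi.single u (m0 G l w) - Pi.single w (m0 G l u), fun h => ?_, ?_⟩
  · have := congrFun h u
    simp [hadj.ne] at this
    exact hpos.ne' this
  · simp [Pi.single_apply, mul_sub, Finset.sum_sub_distrib]
    ring

/-- Let `u` be a vertex of the finite connected simple graph `G` of degree `d ≥ 2`, let
`w₁` be one of its neighbors, and let `G_cut` be obtained by cutting `G` at `u` so that
`u w₁` is the only edge at `u` (the other edges at `u` being re-joined to a clone `ū`).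
If `G_cut` is connected and is given the same edge-length function `l` (under
`E(G_cut) ≅ E(G)`), then `λ₁(G_cut, l) ≤ λ₁(G, l)`. -/
theorem lambda1_cut_le {V : Type*} [Fintype V] (G : SimpleGraph V) (hconn : G.Connected)
    (l : V → V → ℝ) (hl : IsLength G l) (u w₁ : V) (hadj : G.Adj u w₁)
    (hdeg : 2 ≤ (nbr G u).card) (hcut : (cutAt G u w₁).Connected) :
    lambda1 (cutAt G u w₁) (cutLen l u) ≤ lambda1 G l := by
  obtain ⟨φ, hφ, hsum⟩ := exists_ne_zero_sum_m0_eq_zero hl hadj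
  refine csInf_le_csInf ⟨0, ?_⟩ ⟨_, φ, hφ, hsum, rfl⟩ ?_
  · rintro r ⟨ψ, -, -, rfl⟩
    exact rayleigh_nonneg (isLength_cutLen hl u w₁) ψ
  · rintro r ⟨ψ, hψ, hψsum, rfl⟩
    refine ⟨ψ ∘ glue u, fun h => hψ (funext fun x => congrFun h (some x)), ?_, ?_⟩
    · exact (sum_m0_cutAt hl ψ).trans hψsum
    · rw [energy_cutAt hl]
      exact congrArg _ (sum_m0_cutAt hl fun x => ψ x ^ 2).symm

end
end

section
/- Let m ≥ 2 and let B be the m×m real symmetric matrix with entries B₁₁ = 2, B₁₂ = B₂₁ = 1, B_{ii} = 1 for 2 ≤ i ≤ m−1, B_{mm} = 1/2, B_{i,i+1} = B_{i+1,i} = −1/2 for 2 ≤ i ≤ m−1, and all other entries 0. Then B is positive semidefinite and its kernel is exactly the one-dimensional span of the vector (1, −2, −2, …, −2)ᵀ. -/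
open Matrix

/-- The weighted difference matrix `C` of size `(n + 1) × (n + 2)`, sending `x` to the successive
differences of `(-2 * x 0, x 1, …, x (n + 1))`. -/
def weightedDiff (n : ℕ) : Matrix (Fin (n + 1)) (Fin (n + 2)) ℝ := fun k j =>
  (if (j : ℕ) = 0 then -2 else 1) *
    ((if (j : ℕ) = k then 1 else 0) - if (j : ℕ) = k + 1 then 1 else 0)

lemma sum_range_diff_indicator_mul (N i : ℕ) (g : ℕ → ℝ) :
    ∑ k ∈ Finset.range N, ((if i = k then 1 else 0) - if i = k + 1 then 1 else 0) * g k =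
      (if i < N then g i else 0) - if 1 ≤ i ∧ i ≤ N then g (i - 1) else 0 := by
  induction N with
  | zero => grind [Finset.sum_range_zero]
  | succ N ih =>
    rw [Finset.sum_range_succ, ih]
    grind

lemma weightedDiff_mulVec (n : ℕ) (x : Fin (n + 2) → ℝ) (k : Fin (n + 1)) :
    (weightedDiff n *ᵥ x) k =
      (if (k : ℕ) = 0 then -2 else 1) * x k.castSucc - x k.succ := by
  have h (j : Fin (n + 2)) : weightedDiff n k j * x j =
      (if j = k.castSucc then (if (k : ℕ) = 0 then -2 else 1) * x k.castSucc else 0) -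
        if j = k.succ then x k.succ else 0 := by
    simp only [weightedDiff, Fin.ext_iff, Fin.val_castSucc, Fin.val_succ]
    by_cases h₁ : j = k.castSucc
    · subst h₁; simp
    by_cases h₂ : j = k.succ
    · subst h₂; simp
    have h₁' : (j : ℕ) ≠ k := fun h => h₁ (Fin.ext h)
    have h₂' : (j : ℕ) ≠ k + 1 := fun h => h₂ (Fin.ext h)
    simp [h₁', h₂']
  simp only [Matrix.mulVec, dotProduct, h, Finset.sum_sub_distrib, Finset.sum_ite_eq',
    Finset.mem_univ, if_true]

lemma weightedDiff_mulVec_eq_zero_iff (n : ℕ) (x : Fin (n + 2) → ℝ) :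
    weightedDiff n *ᵥ x = 0 ↔
      ∃ c : ℝ, x = fun i : Fin (n + 2) => c * (if (i : ℕ) = 0 then 1 else -2) := by
  simp only [funext_iff, weightedDiff_mulVec, Pi.zero_apply]
  constructor
  · intro h
    refine ⟨x 0, fun i => ?_⟩
    induction i using Fin.induction with
    | zero => simp
    | succ k ih =>
      have hk := h k
      rw [ih] at hk
      simp only [Fin.val_castSucc, Fin.val_succ] at hk ⊢
      split_ifs at hk ⊢ <;> first | contradiction | linarith
  · rintro ⟨c, hc⟩ k
    simp only [hc, Fin.val_castSucc, Fin.val_succ]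
    split_ifs <;> first | contradiction | ring

lemma conjTranspose_weightedDiff_mul_self_apply (n : ℕ) (i j : Fin (n + 2)) :
    ((weightedDiff n)ᴴ * weightedDiff n) i j = 2 *
      (if i = j then (if (i : ℕ) = 0 then 2 else if (i : ℕ) = n + 1 then 1 / 2 else 1)
      else if ((i : ℕ) = 0 ∧ (j : ℕ) = 1) ∨ ((i : ℕ) = 1 ∧ (j : ℕ) = 0) then 1
      else if (i : ℕ) + 1 = (j : ℕ) ∨ (j : ℕ) + 1 = (i : ℕ) then -(1 / 2) else 0) := by
  have hsum := sum_range_diff_indicator_mul (n + 1) i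
    fun k => (if (j : ℕ) = k then 1 else 0) - if (j : ℕ) = k + 1 then 1 else 0
  rw [← Fin.sum_univ_eq_sum_range (fun k => ((if (i : ℕ) = k then (1 : ℝ) else 0) -
    if (i : ℕ) = k + 1 then 1 else 0) *
      ((if (j : ℕ) = k then 1 else 0) - if (j : ℕ) = k + 1 then 1 else 0))] at hsum
  simp only [Matrix.mul_apply, Matrix.conjTranspose_apply, weightedDiff, star_trivial,
    Fin.ext_iff]
  rw [Finset.sum_congr rfl fun k _ => mul_mul_mul_comm _ _ _ _, ← Finset.mul_sum, hsum]
  clear hsum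
  have hi := i.isLt
  have hj := j.isLt
  generalize (i : ℕ) = a at *
  generalize (j : ℕ) = b at *
  grind

/-- Let `m ≥ 2` and let `B` be the `m × m` real symmetric matrix with `B₁₁ = 2`,
`B₁₂ = B₂₁ = 1`, `B_{ii} = 1` for `2 ≤ i ≤ m−1`, `B_{mm} = 1/2`,
`B_{i,i+1} = B_{i+1,i} = −1/2` for `2 ≤ i ≤ m−1`, and all other entries `0`
(indices written `1`-based; here `0`-based over `Fin m`). Then `B` is positive
semidefinite and its kernel is exactly the span of `(1, −2, −2, …, −2)ᵀ`. -/
theorem matrixB_posSemidef_kernel (m : ℕ) (hm : 2 ≤ m)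
    (B : Matrix (Fin m) (Fin m) ℝ)
    (hB : ∀ i j : Fin m, B i j =
      if i = j then (if (i : ℕ) = 0 then 2 else if (i : ℕ) = m - 1 then 1 / 2 else 1)
      else if ((i : ℕ) = 0 ∧ (j : ℕ) = 1) ∨ ((i : ℕ) = 1 ∧ (j : ℕ) = 0) then 1
      else if (i : ℕ) + 1 = (j : ℕ) ∨ (j : ℕ) + 1 = (i : ℕ) then -(1 / 2) else 0) :
    B.PosSemidef ∧
    (∀ x : Fin m → ℝ, B.mulVec x = 0 ↔
      ∃ c : ℝ, x = fun i : Fin m => c * (if (i : ℕ) = 0 then 1 else -2)) := by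
  obtain ⟨n, rfl⟩ := Nat.exists_eq_add_of_le' hm
  have hBC : B = (1 / 2 : ℝ) • ((weightedDiff n)ᴴ * weightedDiff n) := by
    ext i j
    rw [Matrix.smul_apply, conjTranspose_weightedDiff_mul_self_apply, hB, smul_eq_mul,
      ← mul_assoc, one_div_mul_cancel two_ne_zero, one_mul]
    rfl
  refine ⟨?_, fun x => ?_⟩
  · rw [hBC]
    exact (Matrix.posSemidef_conjTranspose_mul_self _).smul (by norm_num)
  · rw [hBC, Matrix.smul_mulVec, smul_eq_zero_iff_right (by norm_num),
      Matrix.conjTranspose_mul_self_mulVec_eq_zero, weightedDiff_mulVec_eq_zero_iff]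
end
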